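/- arXiv:1409.7329 — 2 statements merged into one kernel-verified Lean document; each statement's English description precedes it below -/
import Mathlib

section
/- (Proposition 3.7, analytic curve of solutions) Let R, Rμ, η be positive reals with Rμ > R + 1, and let (γ₁*, β₁*, α₁*, α*, β*, γ*) be a solution of system (S3) satisfying the strict ordering γ₁* < β₁* < α₁* < 0 < α* < β* < γ*. Then there exist real numbers ᾱ₁ ∈ (α₁*, 0] and α̲₁ < α₁*, and a bounded continuous function φ = (φ₁, φ₂, φ₃, φ₄, φ₅, φ₆) : [α̲₁, ᾱ₁] → ℝ⁶, real-analytic on the open interval (α̲₁, ᾱ₁), such that: φ₃(s) = s for all s; φ(α₁*) = (γ₁*, β₁*, α₁*, α*, β*, γ*); for every s ∈ (α̲₁, ᾱ₁), φ(s) is a solution of (S3) satisfying φ₁(s) < φ₂(s) < φ₃(s) < 0 < φ₄(s) < φ₅(s) < φ₆(s); and the endpoints satisfy the reflection relations φ_{7−k}(α̲₁) = −φ_k(ᾱ₁) for k = 1, …, 6. -/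
/-- System (S3) of algebraic equations determining the non-symmetric self-similar
profiles with disconnected supports. -/
def SystemS3 (R Rμ η γ₁ β₁ α₁ α β γ : ℝ) : Prop :=
  γ₁ ^ 2 - (Rμ - R) * β₁ ^ 2 + (Rμ - R - 1) * α₁ ^ 2 = 0 ∧
  γ ^ 2 - (Rμ - R) * β ^ 2 + (Rμ - R - 1) * α ^ 2 = 0 ∧
  R * (γ₁ ^ 2 - γ ^ 2) + (Rμ - R) * (β₁ ^ 2 - β ^ 2) = 0 ∧
  (Rμ - R) * (β ^ 3 - β₁ ^ 3) - R * (Rμ - R - 1) / (1 + R) * (α ^ 3 - α₁ ^ 3)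
    = 9 * η ^ 2 * Rμ ∧
  (γ ^ 3 - γ₁ ^ 3) - (Rμ - R) * (β ^ 3 - β₁ ^ 3) + (Rμ - R - 1) * (α ^ 3 - α₁ ^ 3)
    = 9 * Rμ

open Set Filter Topology in
theorem inv_lemma {f f' : ℝ → ℝ} {a b : ℝ} (hab : a < b) (hc : ContinuousOn f (Icc a b))
    (han : ∀ x ∈ Ioo a b, AnalyticAt ℝ f x)
    (hd : ∀ x ∈ Ioo a b, HasDerivAt f (f' x) x) (hpos : ∀ x ∈ Ioo a b, 0 < f' x) :
    StrictMonoOn f (Icc a b) ∧ ∃ g : ℝ → ℝ, Continuous g ∧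
      (∀ y ∈ Icc (f a) (f b), g y ∈ Icc a b ∧ f (g y) = y) ∧
      (∀ x ∈ Icc a b, g (f x) = x) ∧
      (∀ y ∈ Ioo (f a) (f b), g y ∈ Ioo a b ∧ AnalyticAt ℝ g y ∧ ∃ r > 0, HasDerivAt g r y) := by
  have hmono : StrictMonoOn f (Icc a b) := by
    apply strictMonoOn_of_deriv_pos (convex_Icc a b) hc
    intro x hx
    rw [interior_Icc] at hx
    rw [(hd x hx).deriv]; exact hpos x hx
  refine ⟨hmono, ?_⟩
  have ha : a ∈ Icc a b := ⟨le_rfl, hab.le⟩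
  have hb : b ∈ Icc a b := ⟨hab.le, le_rfl⟩
  have hfab : f a < f b := hmono ha hb hab
  have hsurj : ∀ y ∈ Icc (f a) (f b), ∃ x ∈ Icc a b, f x = y := fun y hy =>
    intermediate_value_Icc hab.le hc hy
  have hch : ∀ y : ℝ, ∃ x : Icc a b, f x = projIcc (f a) (f b) hfab.le y := by
    intro y
    obtain ⟨x, hx, h⟩ := hsurj _ (projIcc (f a) (f b) hfab.le y).2
    exact ⟨⟨x, hx⟩, h⟩
  choose G hG using hch
  have hGm : Monotone G := by
    intro y z hyz
    have : (projIcc (f a) (f b) hfab.le y : ℝ) ≤ projIcc (f a) (f b) hfab.le z :=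
      monotone_projIcc hfab.le hyz
    rw [← hG, ← hG] at this
    exact (hmono.le_iff_le (G y).2 (G z).2).1 this
  have hmap : ∀ x ∈ Icc a b, f x ∈ Icc (f a) (f b) := fun x hx =>
    ⟨hmono.monotoneOn ha hx hx.1, hmono.monotoneOn hx hb hx.2⟩
  have hGf : ∀ y ∈ Icc (f a) (f b), f (G y) = y := by
    intro y hy
    rw [hG, projIcc_of_mem hfab.le hy]
  have hGl : ∀ x ∈ Icc a b, (G (f x) : ℝ) = x := by
    intro x hx
    exact hmono.injOn (G (f x)).2 hx (hGf _ (hmap x hx))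
  have hGs : Function.Surjective G := by
    intro x
    exact ⟨f x, Subtype.ext (hGl x x.2)⟩
  have hGc : Continuous G := hGm.continuous_of_surjective hGs
  refine ⟨fun y => G y, continuous_subtype_val.comp hGc, fun y hy => ⟨(G y).2, hGf y hy⟩, hGl, ?_⟩
  intro y hy
  have hy' : y ∈ Icc (f a) (f b) := Ioo_subset_Icc_self hy
  have hGy : (G y : ℝ) ∈ Ioo a b := by
    constructor
    · refine (hmono.lt_iff_lt ha (G y).2).1 ?_
      rw [hGf y hy']; exact hy.1
    · refine (hmono.lt_iff_lt (G y).2 hb).1 ?_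
      rw [hGf y hy']; exact hy.2
  have hA : AnalyticAt ℝ (fun y => (G y : ℝ)) y := by
    have h1 := analyticAt_comp_iff_of_deriv_ne_zero (g := fun y => (G y : ℝ)) (han _ hGy)
      (by rw [(hd _ hGy).deriv]; exact (hpos _ hGy).ne')
    rw [hGf y hy'] at h1
    refine h1.1 ?_
    refine (analyticAt_id (𝕜 := ℝ)).congr ?_
    filter_upwards [Ioo_mem_nhds hGy.1 hGy.2] with x hx
    exact (hGl x (Ioo_subset_Icc_self hx)).symm
  refine ⟨hGy, hA, (f' (G y))⁻¹, inv_pos.2 (hpos _ hGy), ?_⟩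
  refine HasDerivAt.of_local_left_inverse hA.continuousAt (hd _ hGy) (hpos _ hGy).ne' ?_
  filter_upwards [Ioo_mem_nhds hy.1 hy.2] with z hz
  exact hGf z (Ioo_subset_Icc_self hz)

noncomputable section

def bF (κ x : ℝ) : ℝ := √(1 + κ * x ^ 2)
def cF (m l x : ℝ) : ℝ := √(m - l * x ^ 2)
def fF (κ x : ℝ) : ℝ := bF κ x ^ 3 - κ * x ^ 3
def gF (κ m l x : ℝ) : ℝ := cF m l x ^ 3 - m * bF κ x ^ 3 + (m - 1) * x ^ 3
def hF (κ m l ρ x : ℝ) : ℝ := ρ * fF κ x - gF κ m l x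

end

theorem bF_sq {κ : ℝ} (hκ : 0 < κ) (x : ℝ) : bF κ x ^ 2 = 1 + κ * x ^ 2 :=
  Real.sq_sqrt (by positivity)

theorem bF_pos {κ : ℝ} (hκ : 0 < κ) (x : ℝ) : 0 < bF κ x :=
  Real.sqrt_pos.2 (by positivity)

theorem c_arg_pos {κ m l X x : ℝ} (hκ1 : κ < 1) (hl : 0 < l)
    (hlm : l + m * κ = m - 1) (hX : X ^ 2 * (1 - κ) = 1) (hx : x ∈ Set.Icc 0 X) :
    0 < m - l * x ^ 2 := by
  have h1 : x ^ 2 ≤ X ^ 2 := pow_le_pow_left₀ hx.1 hx.2 2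
  have h2 : m - l * X ^ 2 = X ^ 2 := by linear_combination (-m) * hX - X ^ 2 * hlm 
  have h3 : 0 < X ^ 2 := by
    by_contra h
    nlinarith [sq_nonneg X]
  nlinarith

theorem cF_sq {κ m l X x : ℝ} (hκ1 : κ < 1) (hl : 0 < l)
    (hlm : l + m * κ = m - 1) (hX : X ^ 2 * (1 - κ) = 1) (hx : x ∈ Set.Icc 0 X) :
    cF m l x ^ 2 = m - l * x ^ 2 :=
  Real.sq_sqrt (c_arg_pos hκ1 hl hlm hX hx).le

theorem cF_pos {κ m l X x : ℝ} (hκ1 : κ < 1) (hl : 0 < l)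
    (hlm : l + m * κ = m - 1) (hX : X ^ 2 * (1 - κ) = 1) (hx : x ∈ Set.Icc 0 X) :
    0 < cF m l x :=
  Real.sqrt_pos.2 (c_arg_pos hκ1 hl hlm hX hx)

theorem x_lt_bF {κ X x : ℝ} (hκ : 0 < κ) (_hκ1 : κ < 1)
    (hX : X ^ 2 * (1 - κ) = 1) (hx : x ∈ Set.Ioo 0 X) : x < bF κ x := by
  have h1 : x ^ 2 < X ^ 2 := pow_lt_pow_left₀ hx.2 hx.1.le (by norm_num)
  refine lt_of_pow_lt_pow_left₀ 2 (bF_pos hκ x).le ?_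
  rw [bF_sq hκ]
  nlinarith

theorem bF_lt_cF {κ m l X x : ℝ} (hκ : 0 < κ) (hκ1 : κ < 1) (hl : 0 < l)
    (hlm : l + m * κ = m - 1) (hX : X ^ 2 * (1 - κ) = 1) (hx : x ∈ Set.Ioo 0 X) :
    bF κ x < cF m l x := by
  have h1 : x ^ 2 < X ^ 2 := pow_lt_pow_left₀ hx.2 hx.1.le (by norm_num)
  have hx' := Set.Ioo_subset_Icc_self hx
  refine lt_of_pow_lt_pow_left₀ 2 (cF_pos hκ1 hl hlm hX hx').le ?_
  rw [bF_sq hκ, cF_sq hκ1 hl hlm hX hx']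
  have h2 : (l + κ) * X ^ 2 = m - 1 := by
    linear_combination (m - 1) * hX + X ^ 2 * hlm
  have : (l + κ) * x ^ 2 < (l + κ) * X ^ 2 := by gcongr
  linarith

theorem bF_analytic {κ : ℝ} (hκ : 0 < κ) (x : ℝ) : AnalyticAt ℝ (bF κ) x := by
  have : ContDiffAt ℝ ⊤ (fun x : ℝ => √(1 + κ * x ^ 2)) x := by
    apply ContDiffAt.sqrt
    · fun_prop
    · positivity
  exact this.analyticAt

theorem cF_analytic {κ m l X x : ℝ} (hκ1 : κ < 1) (hl : 0 < l)
    (hlm : l + m * κ = m - 1) (hX : X ^ 2 * (1 - κ) = 1) (hx : x ∈ Set.Icc 0 X) :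
    AnalyticAt ℝ (cF m l) x := by
  have : ContDiffAt ℝ ⊤ (fun x : ℝ => √(m - l * x ^ 2)) x := by
    apply ContDiffAt.sqrt
    · fun_prop
    · exact (c_arg_pos hκ1 hl hlm hX hx).ne'
  exact this.analyticAt

theorem bF_deriv {κ : ℝ} (hκ : 0 < κ) (x : ℝ) : HasDerivAt (bF κ) (κ * x / bF κ x) x := by
  have h : HasDerivAt (fun x : ℝ => 1 + κ * x ^ 2) (κ * (2 * x)) x := by
    have := ((hasDerivAt_pow 2 x).const_mul κ).const_add 1
    simpa using this
  have h2 := h.sqrt (by positivity)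
  refine HasDerivAt.congr_deriv (f := bF κ) h2 ?_
  unfold bF
  have : √(1 + κ * x ^ 2) ≠ 0 := (bF_pos hκ x).ne'
  field_simp

theorem cF_deriv {κ m l X x : ℝ} (hκ1 : κ < 1) (hl : 0 < l)
    (hlm : l + m * κ = m - 1) (hX : X ^ 2 * (1 - κ) = 1) (hx : x ∈ Set.Icc 0 X) :
    HasDerivAt (cF m l) (- l * x / cF m l x) x := by
  have h : HasDerivAt (fun x : ℝ => m - l * x ^ 2) (- (l * (2 * x))) x := by
    have := ((hasDerivAt_pow 2 x).const_mul l).const_sub m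
    simpa using this
  have h2 := h.sqrt (c_arg_pos hκ1 hl hlm hX hx).ne'
  refine HasDerivAt.congr_deriv (f := cF m l) h2 ?_
  unfold cF
  have : √(m - l * x ^ 2) ≠ 0 := (cF_pos hκ1 hl hlm hX hx).ne'
  field_simp

theorem fF_deriv {κ : ℝ} (hκ : 0 < κ) (x : ℝ) :
    HasDerivAt (fF κ) (3 * κ * x * (bF κ x - x)) x := by
  have h := ((bF_deriv hκ x).pow 3).sub ((hasDerivAt_pow 3 x).const_mul κ)
  refine h.congr_deriv ?_
  have := (bF_pos hκ x).ne'
  field_simp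
  push_cast
  ring

theorem gF_deriv {κ m l X x : ℝ} (hκ : 0 < κ) (hκ1 : κ < 1) (hl : 0 < l)
    (hlm : l + m * κ = m - 1) (hX : X ^ 2 * (1 - κ) = 1) (hx : x ∈ Set.Icc 0 X) :
    HasDerivAt (gF κ m l)
      (- (3 * x * (l * (cF m l x - x) + m * κ * (bF κ x - x)))) x := by
  have h := (((cF_deriv hκ1 hl hlm hX hx).pow 3).sub (((bF_deriv hκ x).pow 3).const_mul m)).add
    ((hasDerivAt_pow 3 x).const_mul (m - 1))
  refine h.congr_deriv ?_
  have := (bF_pos hκ x).ne'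
  have := (cF_pos hκ1 hl hlm hX hx).ne'
  rw [← hlm]
  field_simp
  push_cast
  ring

theorem fF_analytic {κ : ℝ} (hκ : 0 < κ) (x : ℝ) : AnalyticAt ℝ (fF κ) x :=
  ((bF_analytic hκ x).pow 3).sub (analyticAt_const.mul (analyticAt_id.pow 3))

theorem gF_analytic {κ m l X x : ℝ} (hκ : 0 < κ) (hκ1 : κ < 1) (hl : 0 < l)
    (hlm : l + m * κ = m - 1) (hX : X ^ 2 * (1 - κ) = 1) (hx : x ∈ Set.Icc 0 X) :
    AnalyticAt ℝ (gF κ m l) x :=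
  (((cF_analytic hκ1 hl hlm hX hx).pow 3).sub (analyticAt_const.mul ((bF_analytic hκ x).pow 3))).add
    (analyticAt_const.mul (analyticAt_id.pow 3))

theorem fF_eq {κ : ℝ} (hκ : 0 < κ) (x : ℝ) :
    fF κ x = bF κ x + κ * x ^ 2 * (bF κ x - x) := by
  unfold fF
  linear_combination (bF κ x) * bF_sq hκ x

theorem fF_pos {κ X x : ℝ} (hκ : 0 < κ) (hκ1 : κ < 1)
    (hX : X ^ 2 * (1 - κ) = 1) (hx : x ∈ Set.Icc 0 X) : 0 < fF κ x := by
  have h1 : x ^ 2 ≤ X ^ 2 := pow_le_pow_left₀ hx.1 hx.2 2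
  have h : x ≤ bF κ x := by
    refine le_of_pow_le_pow_left₀ (n := 2) (by norm_num) (bF_pos hκ x).le ?_
    rw [bF_sq hκ]
    nlinarith
  rw [fF_eq hκ]
  have := bF_pos hκ x
  have : 0 ≤ κ * x ^ 2 * (bF κ x - x) := mul_nonneg (by positivity) (by linarith)
  linarith

open Set Filter Topology in
theorem core {κ m l ρ X K u0 v0 q0 : ℝ} (hκ : 0 < κ) (hκ1 : κ < 1) (hl : 0 < l)
    (hlm : l + m * κ = m - 1) (hm : 1 < m) (hρ : 0 < ρ) (hK : 0 < K) (hX0 : 0 < X)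
    (hX : X ^ 2 * (1 - κ) = 1)
    (hu0 : u0 ∈ Ioo 0 X) (hv0 : v0 ∈ Ioo 0 X) (hq0 : 0 < q0)
    (hH0 : hF κ m l ρ u0 + hF κ m l ρ v0 = 0) (hF0 : q0 ^ 3 * (fF κ u0 + fF κ v0) = K) :
    ∃ (a b : ℝ) (u v q : ℝ → ℝ), a < -(q0 * u0) ∧ -(q0 * u0) < b ∧ b ≤ 0 ∧
      (ContinuousOn u (Icc a b) ∧ ContinuousOn v (Icc a b) ∧ ContinuousOn q (Icc a b)) ∧
      (∀ s ∈ Icc a b, u s ∈ Icc 0 X ∧ v s ∈ Icc 0 X ∧ q s * u s = -s) ∧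
      (∀ s ∈ Ioo a b, AnalyticAt ℝ u s ∧ AnalyticAt ℝ v s ∧ AnalyticAt ℝ q s ∧
        u s ∈ Ioo 0 X ∧ v s ∈ Ioo 0 X ∧ 0 < q s ∧
        hF κ m l ρ (u s) + hF κ m l ρ (v s) = 0 ∧ q s ^ 3 * (fF κ (u s) + fF κ (v s)) = K) ∧
      (u (-(q0 * u0)) = u0 ∧ v (-(q0 * u0)) = v0 ∧ q (-(q0 * u0)) = q0) ∧
      (u a = v b ∧ v a = u b ∧ q a = q b) := by
  have hHan : ∀ x ∈ Icc 0 X, AnalyticAt ℝ (hF κ m l ρ) x := fun x hx =>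
    (analyticAt_const.mul (fF_analytic hκ x)).sub (gF_analytic hκ hκ1 hl hlm hX hx)
  obtain ⟨hHm, G, hGc, hG1, hG2, hG3⟩ := inv_lemma (f := hF κ m l ρ)
    (f' := fun x => ρ * (3 * κ * x * (bF κ x - x)) -
      (- (3 * x * (l * (cF m l x - x) + m * κ * (bF κ x - x))))) hX0
    (fun x hx => (hHan x hx).continuousAt.continuousWithinAt)
    (fun x hx => hHan x (Ioo_subset_Icc_self hx))
    (fun x hx => ((fF_deriv hκ x).const_mul ρ).sub
      (gF_deriv hκ hκ1 hl hlm hX (Ioo_subset_Icc_self hx)))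
    (by
      intro x hx
      have h1 := sub_pos.2 (x_lt_bF hκ hκ1 hX hx)
      have h2 : 0 < cF m l x - x := by linarith [bF_lt_cF hκ hκ1 hl hlm hX hx]
      have := hx.1
      simp only [sub_neg_eq_add]
      positivity)
  set H := hF κ m l ρ with hHdef
  have h0m : (0:ℝ) ∈ Icc 0 X := ⟨le_rfl, hX0.le⟩
  have hXm : X ∈ Icc 0 X := ⟨hX0.le, le_rfl⟩
  have hu1 := hHm h0m (Ioo_subset_Icc_self hu0) hu0.1
  have hu2 := hHm (Ioo_subset_Icc_self hu0) hXm hu0.2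
  have hv1 := hHm h0m (Ioo_subset_Icc_self hv0) hv0.1
  have hv2 := hHm (Ioo_subset_Icc_self hv0) hXm hv0.2
  obtain ⟨M, hM1, hM2, hM3⟩ : ∃ M, M ≤ H X ∧ M ≤ - H 0 ∧ |H v0| < M := by
    refine ⟨min (H X) (-H 0), min_le_left _ _, min_le_right _ _, ?_⟩
    rw [abs_lt, lt_min_iff]
    constructor
    · rcases min_cases (H X) (-H 0) with h | h <;> linarith
    · constructor <;> linarith
  have hM0 : 0 < M := lt_of_le_of_lt (abs_nonneg _) hM3
  have hIcc : ∀ t ∈ Icc (-M) M, t ∈ Icc (H 0) (H X) := fun t ht =>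
    ⟨by linarith [ht.1], by linarith [ht.2]⟩
  have hIoo : ∀ t ∈ Ioo (-M) M, t ∈ Ioo (H 0) (H X) := fun t ht =>
    ⟨by linarith [ht.1], by linarith [ht.2]⟩
  have hnIcc : ∀ t ∈ Icc (-M) M, -t ∈ Icc (-M) M := fun t ht =>
    ⟨by linarith [ht.2], by linarith [ht.1]⟩
  have hnIoo : ∀ t ∈ Ioo (-M) M, -t ∈ Ioo (-M) M := fun t ht =>
    ⟨by linarith [ht.2], by linarith [ht.1]⟩
  let D : ℝ → ℝ := fun t => fF κ (G t) + fF κ (G (-t))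
  have hDpos : ∀ t ∈ Icc (-M) M, 0 < D t := fun t ht =>
    add_pos (fF_pos hκ hκ1 hX (hG1 t (hIcc t ht)).1)
      (fF_pos hκ hκ1 hX (hG1 _ (hIcc _ (hnIcc t ht))).1)
  let Q : ℝ → ℝ := fun t => Real.exp ((Real.log K - Real.log (D t)) / 3)
  have hQpos : ∀ t, 0 < Q t := fun t => Real.exp_pos _
  have hQ3 : ∀ t ∈ Icc (-M) M, Q t ^ 3 * D t = K := by
    intro t ht
    have : Q t ^ 3 = K / D t := by
      simp only [Q]
      rw [← Real.exp_nat_mul]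
      rw [show ((3:ℕ):ℝ) * ((Real.log K - Real.log (D t)) / 3) = Real.log K - Real.log (D t) by
        push_cast; ring]
      rw [Real.exp_sub, Real.exp_log hK, Real.exp_log (hDpos t ht)]
    rw [this, div_mul_cancel₀ _ (hDpos t ht).ne']
  have hDev : ∀ t, D (-t) = D t := by
    intro t; simp only [D, neg_neg]; ring
  have hQev : ∀ t, Q (-t) = Q t := by
    intro t; simp only [Q, hDev]
  have hfc : Continuous (fF κ) := continuous_iff_continuousAt.2
    fun x => (fF_analytic hκ x).continuousAt
  have hDc : Continuous D := (hfc.comp hGc).add (hfc.comp (hGc.comp continuous_neg))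
  have hQc : ContinuousOn Q (Icc (-M) M) := by
    refine Real.continuous_exp.comp_continuousOn ?_
    refine ContinuousOn.div_const (continuousOn_const.sub ?_) _
    exact ContinuousOn.log hDc.continuousOn (fun t ht => (hDpos t ht).ne')
  have hGan : ∀ t ∈ Ioo (-M) M, AnalyticAt ℝ G t := fun t ht => (hG3 t (hIoo t ht)).2.1
  have hGnan : ∀ t ∈ Ioo (-M) M, AnalyticAt ℝ (fun t => G (-t)) t := fun t ht =>
    AnalyticAt.fun_comp (hGan (-t) (hnIoo t ht)) (analyticAt_id.neg)
  have hDan : ∀ t ∈ Ioo (-M) M, AnalyticAt ℝ D t := fun t ht =>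
    ((fF_analytic hκ _).fun_comp (hGan t ht)).add ((fF_analytic hκ _).fun_comp (hGnan t ht))
  have hQan : ∀ t ∈ Ioo (-M) M, AnalyticAt ℝ Q t := fun t ht =>
    AnalyticAt.rexp' ((analyticAt_const.sub
      ((hDan t ht).log (hDpos t (Ioo_subset_Icc_self ht)))).div analyticAt_const (by norm_num))
  let A : ℝ → ℝ := fun t => -(Q t * G (-t))
  have hAder : ∀ t ∈ Ioo (-M) M, ∃ d > 0, HasDerivAt A d t := by
    intro t ht
    obtain ⟨hv, -, r, hr, hGr⟩ := hG3 t (hIoo t ht)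
    obtain ⟨hu, -, p, hp, hGp⟩ := hG3 (-t) (hIoo _ (hnIoo t ht))
    have hGn : HasDerivAt (fun t => G (-t)) (-p) t := by
      have := HasDerivAt.comp t hGp (hasDerivAt_neg t)
      rw [mul_neg_one] at this
      exact this
    have hD' : HasDerivAt D (3 * κ * G t * (bF κ (G t) - G t) * r +
        3 * κ * G (-t) * (bF κ (G (-t)) - G (-t)) * (-p)) t :=
      (HasDerivAt.comp t (fF_deriv hκ (G t)) hGr).add
        (HasDerivAt.comp t (h := fun t => G (-t)) (fF_deriv hκ (G (-t))) hGn)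
    have hDp := hDpos t (Ioo_subset_Icc_self ht)
    have hQ' := (((hD'.log hDp.ne').const_sub (Real.log K)).div_const 3).exp
    have hA' := (hQ'.mul hGn).neg
    refine ⟨_, ?_, hA'⟩
    change 0 < -(Q t * _ * G (-t) + Q t * _)
    have hDe : D t = fF κ (G t) + fF κ (G (-t)) := rfl
    have hfv := fF_pos hκ hκ1 hX (Ioo_subset_Icc_self hv)
    have hbu := x_lt_bF hκ hκ1 hX hu
    have hbv := x_lt_bF hκ hκ1 hX hv
    have hfu := fF_eq hκ (G (-t))
    have hbup := bF_pos hκ (G (-t))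
    have hu' := hu.1
    have hv' := hv.1
    have hQp := hQpos t
    generalize Q t = Qt at *
    generalize D t = Dt at *
    generalize G (-t) = uu at *
    generalize G t = vv at *
    generalize bF κ uu = bu at *
    generalize bF κ vv = bv at *
    have key : 0 < 3 * Dt * p + uu * (3 * κ * vv * (bv - vv) * r)
        - uu * (3 * κ * uu * (bu - uu)) * p := by
      have e1 : 0 < uu * (3 * κ * vv * (bv - vv) * r) := by
        have := sub_pos.2 hbv
        positivity
      have e2 : 0 < p * (3 * fF κ vv + 3 * bu) := by positivity
      rw [hDe, hfu]
      nlinarith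
    have : 0 < Qt / (3 * Dt) * (3 * Dt * p + uu * (3 * κ * vv * (bv - vv) * r)
        - uu * (3 * κ * uu * (bu - uu)) * p) := by positivity
    refine lt_of_lt_of_eq this ?_
    have := hDp.ne'
    field_simp
    ring
  have hAan : ∀ t ∈ Ioo (-M) M, AnalyticAt ℝ A t := fun t ht =>
    ((hQan t ht).mul (hGnan t ht)).neg
  have hAc : ContinuousOn A (Icc (-M) M) :=
    (hQc.mul (hGc.comp continuous_neg).continuousOn).neg
  obtain ⟨hAm, T, hTc, hT1, hT2, hT3⟩ := inv_lemma (f := A) (f' := fun t => deriv A t)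
    (by linarith : -M < M) hAc hAan
    (fun t ht => by
      obtain ⟨d, _, h⟩ := hAder t ht
      exact h.differentiableAt.hasDerivAt)
    (fun t ht => by
      obtain ⟨d, hd, h⟩ := hAder t ht
      simp only [h.deriv]; exact hd)
  have ht0 : H v0 ∈ Ioo (-M) M := abs_lt.1 hM3
  have ht0' := Ioo_subset_Icc_self ht0
  have hMl : -M ∈ Icc (-M) M := ⟨le_rfl, by linarith⟩
  have hMr : M ∈ Icc (-M) M := ⟨by linarith, le_rfl⟩
  have hGt0 : G (H v0) = v0 := hG2 v0 (Ioo_subset_Icc_self hv0)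
  have hGnt0 : G (-H v0) = u0 := by
    rw [show -H v0 = H u0 by linarith]
    exact hG2 u0 (Ioo_subset_Icc_self hu0)
  have hQt0 : Q (H v0) = q0 := by
    have h1 := hQ3 _ ht0'
    have h2 := hDpos _ ht0'
    have h3 : D (H v0) = fF κ u0 + fF κ v0 := by
      simp only [D, hGt0, hGnt0]; ring
    rw [h3] at h1 h2
    rw [← hF0] at h1
    exact (pow_left_inj₀ (hQpos _).le hq0.le (by norm_num)).1 (mul_right_cancel₀ h2.ne' h1)
  have hAt0 : A (H v0) = -(q0 * u0) := by simp only [A, hQt0, hGnt0]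
  have hTt0 : T (-(q0 * u0)) = H v0 := by rw [← hAt0]; exact hT2 _ ht0'
  have hTa : T (A (-M)) = -M := hT2 _ hMl
  have hTb : T (A M) = M := hT2 _ hMr
  have hTmaps : MapsTo T (Icc (A (-M)) (A M)) (Icc (-M) M) := fun s hs => (hT1 s hs).1
  refine ⟨A (-M), A M, fun s => G (-T s), fun s => G (T s), fun s => Q (T s), ?_, ?_, ?_,
    ⟨?_, ?_, ?_⟩, ?_, ?_, ⟨?_, ?_, ?_⟩, ?_, ?_, ?_⟩
  · rw [← hAt0]; exact hAm hMl ht0' ht0.1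
  · rw [← hAt0]; exact hAm ht0' hMr ht0.2
  · have := (hG1 _ (hIcc _ hMl)).1.1
    have := mul_nonneg (hQpos M).le this
    simp only [A]; linarith
  · exact (hGc.comp (continuous_neg.comp hTc)).continuousOn
  · exact (hGc.comp hTc).continuousOn
  · exact hQc.comp hTc.continuousOn hTmaps
  · intro s hs
    have hTs := hTmaps hs
    refine ⟨(hG1 _ (hIcc _ (hnIcc _ hTs))).1, (hG1 _ (hIcc _ hTs)).1, ?_⟩
    have := (hT1 s hs).2
    simp only [A] at this
    linarith
  · intro s hs
    obtain ⟨hTs, hTan, -⟩ := hT3 s hs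
    have hTs' := Ioo_subset_Icc_self hTs
    refine ⟨(hGnan _ hTs).fun_comp hTan, (hGan _ hTs).fun_comp hTan, (hQan _ hTs).fun_comp hTan,
      (hG3 _ (hIoo _ (hnIoo _ hTs))).1, (hG3 _ (hIoo _ hTs)).1, hQpos _, ?_, ?_⟩
    · rw [(hG1 _ (hIcc _ (hnIcc _ hTs'))).2, (hG1 _ (hIcc _ hTs')).2]; ring
    · have := hQ3 _ hTs'
      simp only [D] at this
      rw [add_comm] at this
      linarith
  · simp only [hTt0, hGnt0]
  · simp only [hTt0, hGt0]
  · simp only [hTt0, hQt0]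
  · simp only [hTa, hTb, neg_neg]
  · simp only [hTa, hTb]
  · simp only [hTa, hTb, hQev]

theorem bF_scale {κ a b q : ℝ} (hq : 0 < q) (hb : 0 < b) (h : b ^ 2 = q ^ 2 + κ * a ^ 2) :
    bF κ (a / q) = b / q := by
  unfold bF
  rw [Real.sqrt_eq_iff_mul_self_eq_of_pos (by positivity)]
  field_simp
  linarith

theorem cF_scale {m l a c q : ℝ} (hq : 0 < q) (hc : 0 < c) (h : c ^ 2 = m * q ^ 2 - l * a ^ 2) :
    cF m l (a / q) = c / q := by
  unfold cF
  rw [Real.sqrt_eq_iff_mul_self_eq_of_pos (by positivity)]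
  field_simp
  linarith

theorem fF_scale {κ a b q : ℝ} (hq : 0 < q) (hb : 0 < b) (h : b ^ 2 = q ^ 2 + κ * a ^ 2) :
    q ^ 3 * fF κ (a / q) = b ^ 3 - κ * a ^ 3 := by
  unfold fF
  rw [bF_scale hq hb h]
  field_simp

theorem gF_scale {κ m l a b c q : ℝ} (hq : 0 < q) (hb : 0 < b) (h : b ^ 2 = q ^ 2 + κ * a ^ 2)
    (hc : 0 < c) (h' : c ^ 2 = m * q ^ 2 - l * a ^ 2) :
    q ^ 3 * gF κ m l (a / q) = c ^ 3 - m * b ^ 3 + (m - 1) * a ^ 3 := by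
  unfold gF
  rw [bF_scale hq hb h, cF_scale hq hc h']
  field_simp

theorem mem_scale {κ a b q X : ℝ} (hq : 0 < q) (hX0 : 0 < X) (hX : X ^ 2 * (1 - κ) = 1)
    (ha : 0 < a) (hab : a < b) (h : b ^ 2 = q ^ 2 + κ * a ^ 2) (hκ : κ < 1) :
    a / q ∈ Set.Ioo 0 X := by
  refine ⟨by positivity, ?_⟩
  rw [div_lt_iff₀ hq]
  refine lt_of_pow_lt_pow_left₀ 2 (by positivity) ?_
  have h1 : a ^ 2 < b ^ 2 := pow_lt_pow_left₀ hab ha.le (by norm_num)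
  have h2 : a ^ 2 * (1 - κ) < q ^ 2 := by linarith
  have h3 : 0 < X ^ 2 := by positivity
  nlinarith

/-- Proposition 3.7: every strictly ordered solution of (S3) lies on a bounded
continuous curve `φ : [α̲₁, ᾱ₁] → ℝ⁶`, real-analytic in the interior, parametrized by
its third component, consisting of strictly ordered solutions of (S3), whose endpoints
are related by the reflection `φ_{7−k}(α̲₁) = −φ_k(ᾱ₁)`. -/
theorem systemS3_analytic_curve (R Rμ η : ℝ)
    (hR : 0 < R) (hRμ : 0 < Rμ) (hη : 0 < η) (hgt : R + 1 < Rμ)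
    (γ₁s β₁s α₁s αs βs γs : ℝ)
    (hord : γ₁s < β₁s ∧ β₁s < α₁s ∧ α₁s < 0 ∧ 0 < αs ∧ αs < βs ∧ βs < γs)
    (hsol : SystemS3 R Rμ η γ₁s β₁s α₁s αs βs γs) :
    ∃ (a b : ℝ) (φ : Fin 6 → ℝ → ℝ),
      a < α₁s ∧ α₁s < b ∧ b ≤ 0 ∧
      (∀ k : Fin 6, ContinuousOn (φ k) (Set.Icc a b)) ∧
      (∀ k : Fin 6, Bornology.IsBounded (φ k '' Set.Icc a b)) ∧
      (∀ k : Fin 6, AnalyticOnNhd ℝ (φ k) (Set.Ioo a b)) ∧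
      (∀ s ∈ Set.Icc a b, φ 2 s = s) ∧
      (φ 0 α₁s = γ₁s ∧ φ 1 α₁s = β₁s ∧ φ 2 α₁s = α₁s ∧
        φ 3 α₁s = αs ∧ φ 4 α₁s = βs ∧ φ 5 α₁s = γs) ∧
      (∀ s ∈ Set.Ioo a b,
        SystemS3 R Rμ η (φ 0 s) (φ 1 s) (φ 2 s) (φ 3 s) (φ 4 s) (φ 5 s) ∧
        φ 0 s < φ 1 s ∧ φ 1 s < φ 2 s ∧ φ 2 s < 0 ∧
        0 < φ 3 s ∧ φ 3 s < φ 4 s ∧ φ 4 s < φ 5 s) ∧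
      (∀ k : Fin 6, φ (5 - k) a = -(φ k b)) := by
  
  obtain ⟨e1, e2, e3, e4, e5⟩ := hsol
  obtain ⟨o1, o2, o3, o4, o5, o6⟩ := hord
  obtain ⟨m, hmdef⟩ : ∃ m, m = Rμ - R := ⟨_, rfl⟩
  obtain ⟨κ, hκdef⟩ : ∃ κ, κ = R * (m - 1) / (m * (1 + R)) := ⟨_, rfl⟩
  obtain ⟨l, hldef⟩ : ∃ l, l = (m - 1) / (1 + R) := ⟨_, rfl⟩
  have hm : 1 < m := by linarith
  have hm1 : 0 < m - 1 := by linarith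
  have hm0 : 0 < m := by linarith
  have hκ : 0 < κ := by rw [hκdef]; positivity
  have hκ1 : κ < 1 := by
    rw [hκdef, div_lt_one (by positivity)]
    nlinarith
  have hl : 0 < l := by rw [hldef]; positivity
  have hlm : l + m * κ = m - 1 := by
    rw [hldef, hκdef]; field_simp
  have hmκ : R * (m - 1) / (1 + R) = m * κ := by rw [hκdef]; field_simp
  have hκR : m * κ = R * l := by rw [hldef, hκdef]; field_simp
  have hRl : (1 + R) * l = m - 1 := by rw [hldef]; field_simp
  obtain ⟨X, hX0, hX⟩ : ∃ X : ℝ, 0 < X ∧ X ^ 2 * (1 - κ) = 1 := by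
    have : 0 < 1 - κ := by linarith
    refine ⟨√(1 / (1 - κ)), Real.sqrt_pos.2 (by positivity), ?_⟩
    rw [Real.sq_sqrt (by positivity)]
    field_simp
  unfold SystemS3
  rw [← hmdef] at e1 e2 e3 e4 e5 ⊢
  rw [hmκ] at e4 ⊢
  have hP : 0 < βs ^ 2 - κ * αs ^ 2 := by
    have : αs ^ 2 < βs ^ 2 := pow_lt_pow_left₀ o5 o4.le (by norm_num)
    nlinarith [sq_nonneg αs]
  obtain ⟨q0, hq0, hq0s⟩ : ∃ q0 : ℝ, 0 < q0 ∧ q0 ^ 2 = βs ^ 2 - κ * αs ^ 2 :=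
    ⟨_, Real.sqrt_pos.2 hP, Real.sq_sqrt hP.le⟩
  have hb : βs ^ 2 = q0 ^ 2 + κ * αs ^ 2 := by linarith
  have hc : γs ^ 2 = m * q0 ^ 2 - l * αs ^ 2 := by
    linear_combination e2 - m * hq0s + αs ^ 2 * hlm
  have hb1 : (-β₁s) ^ 2 = q0 ^ 2 + κ * (-α₁s) ^ 2 := by
    have h : (m * (1 + R)) * ((-β₁s) ^ 2 - (q0 ^ 2 + κ * (-α₁s) ^ 2)) = 0 := by
      rw [hq0s, hκdef]
      field_simp
      linear_combination e3 - R * e1 + R * e2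
    have h' : m * (1 + R) ≠ 0 := by positivity
    have := (mul_eq_zero.1 h).resolve_left h'
    linarith
  have hc1 : (-γ₁s) ^ 2 = m * q0 ^ 2 - l * (-α₁s) ^ 2 := by
    linear_combination e1 + m * hb1 + α₁s ^ 2 * hlm
  have hβp : 0 < βs := by linarith
  have hγp : 0 < γs := by linarith
  have hβ1p : 0 < -β₁s := by linarith
  have hγ1p : 0 < -γ₁s := by linarith
  have fv := fF_scale hq0 hβp hb
  have fu := fF_scale hq0 hβ1p hb1
  have gv := gF_scale hq0 hβp hb hγp hc
  have gu := gF_scale hq0 hβ1p hb1 hγ1p hc1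
  have hu0 := mem_scale hq0 hX0 hX (by linarith : 0 < -α₁s) (by linarith : -α₁s < -β₁s) hb1 hκ1
  have hv0 := mem_scale hq0 hX0 hX o4 o5 hb hκ1
  have hF0 : q0 ^ 3 * (fF κ (-α₁s / q0) + fF κ (αs / q0)) = 9 * η ^ 2 * Rμ / m := by
    rw [mul_add, fu, fv]
    field_simp
    linear_combination e4
  have hG0 : q0 ^ 3 * (gF κ m l (-α₁s / q0) + gF κ m l (αs / q0)) = 9 * Rμ := by
    rw [mul_add, gu, gv]
    linear_combination e5
  have hH0 : hF κ m l (m / η ^ 2) (-α₁s / q0) + hF κ m l (m / η ^ 2) (αs / q0) = 0 := by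
    have h : q0 ^ 3 * (hF κ m l (m / η ^ 2) (-α₁s / q0) + hF κ m l (m / η ^ 2) (αs / q0)) = 0 := by
      have : m / η ^ 2 * (9 * η ^ 2 * Rμ / m) = 9 * Rμ := by field_simp
      unfold hF
      linear_combination (m / η ^ 2) * hF0 - hG0 + this
    exact (mul_eq_zero.1 h).resolve_left (by positivity)
  obtain ⟨a, b, u, v, q, ha, hb', hb0, ⟨huc, hvc, hqc⟩, hIcc, hIoo, ⟨hu, hv, hq⟩, hs1, hs2, hs3⟩ :=
    core hκ hκ1 hl hlm hm (by positivity : 0 < m / η ^ 2)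
      (by positivity : 0 < 9 * η ^ 2 * Rμ / m) hX0 hX hu0 hv0 hq0 hH0 hF0
  have hs0 : -(q0 * (-α₁s / q0)) = α₁s := by field_simp
  rw [hs0] at ha hb' hu hv hq
  have hbc : Continuous (bF κ) := continuous_iff_continuousAt.2
    fun x => (bF_analytic hκ x).continuousAt
  have hcc : ContinuousOn (cF m l) (Set.Icc 0 X) :=
    fun x hx => (cF_analytic hκ1 hl hlm hX hx).continuousAt.continuousWithinAt
  have hcuc : ContinuousOn (fun s => cF m l (u s)) (Set.Icc a b) :=
    hcc.comp huc (fun s hs => (hIcc s hs).1)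
  have hcvc : ContinuousOn (fun s => cF m l (v s)) (Set.Icc a b) :=
    hcc.comp hvc (fun s hs => (hIcc s hs).2.1)
  have hbuc : ContinuousOn (fun s => bF κ (u s)) (Set.Icc a b) := hbc.comp_continuousOn huc
  have hbvc : ContinuousOn (fun s => bF κ (v s)) (Set.Icc a b) := hbc.comp_continuousOn hvc
  let φ : Fin 6 → ℝ → ℝ := ![fun s => -(q s * cF m l (u s)), fun s => -(q s * bF κ (u s)),
    fun s => -(q s * u s), fun s => q s * v s, fun s => q s * bF κ (v s),
    fun s => q s * cF m l (v s)]
  have hcont : ∀ k : Fin 6, ContinuousOn (φ k) (Set.Icc a b) := by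
    intro k
    fin_cases k
    · exact (hqc.mul hcuc).neg
    · exact (hqc.mul hbuc).neg
    · exact (hqc.mul huc).neg
    · exact hqc.mul hvc
    · exact hqc.mul hbvc
    · exact hqc.mul hcvc
  refine ⟨a, b, φ, ha, hb', hb0, hcont, fun k => (isCompact_Icc.image_of_continuousOn (hcont k)).isBounded,
    ?_, ?_, ?_, ?_, ?_⟩
  · intro k s hs
    obtain ⟨hua, hva, hqa, hus, hvs, -⟩ := hIoo s hs
    have hcu := (cF_analytic hκ1 hl hlm hX (Set.Ioo_subset_Icc_self hus)).fun_comp hua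
    have hcv := (cF_analytic hκ1 hl hlm hX (Set.Ioo_subset_Icc_self hvs)).fun_comp hva
    have hbu := (bF_analytic hκ (u s)).fun_comp hua
    have hbv := (bF_analytic hκ (v s)).fun_comp hva
    fin_cases k
    · exact (hqa.mul hcu).neg
    · exact (hqa.mul hbu).neg
    · exact (hqa.mul hua).neg
    · exact hqa.mul hva
    · exact hqa.mul hbv
    · exact hqa.mul hcv
  · intro s hs
    change -(q s * u s) = s
    linarith [(hIcc s hs).2.2]
  · change -(q α₁s * cF m l (u α₁s)) = γ₁s ∧ -(q α₁s * bF κ (u α₁s)) = β₁s ∧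
      -(q α₁s * u α₁s) = α₁s ∧ q α₁s * v α₁s = αs ∧ q α₁s * bF κ (v α₁s) = βs ∧
      q α₁s * cF m l (v α₁s) = γs
    rw [hu, hv, hq, bF_scale hq0 hβp hb, bF_scale hq0 hβ1p hb1, cF_scale hq0 hγp hc,
      cF_scale hq0 hγ1p hc1]
    refine ⟨?_, ?_, ?_, ?_, ?_, ?_⟩ <;> field_simp
  · intro s hs
    change ((-(q s * cF m l (u s))) ^ 2 - m * (-(q s * bF κ (u s))) ^ 2
        + (m - 1) * (-(q s * u s)) ^ 2 = 0 ∧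
      (q s * cF m l (v s)) ^ 2 - m * (q s * bF κ (v s)) ^ 2 + (m - 1) * (q s * v s) ^ 2 = 0 ∧
      R * ((-(q s * cF m l (u s))) ^ 2 - (q s * cF m l (v s)) ^ 2)
        + m * ((-(q s * bF κ (u s))) ^ 2 - (q s * bF κ (v s)) ^ 2) = 0 ∧
      m * ((q s * bF κ (v s)) ^ 3 - (-(q s * bF κ (u s))) ^ 3)
        - m * κ * ((q s * v s) ^ 3 - (-(q s * u s)) ^ 3) = 9 * η ^ 2 * Rμ ∧
      ((q s * cF m l (v s)) ^ 3 - (-(q s * cF m l (u s))) ^ 3)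
        - m * ((q s * bF κ (v s)) ^ 3 - (-(q s * bF κ (u s))) ^ 3)
        + (m - 1) * ((q s * v s) ^ 3 - (-(q s * u s)) ^ 3) = 9 * Rμ) ∧
      -(q s * cF m l (u s)) < -(q s * bF κ (u s)) ∧ -(q s * bF κ (u s)) < -(q s * u s) ∧
      -(q s * u s) < 0 ∧ 0 < q s * v s ∧ q s * v s < q s * bF κ (v s) ∧
      q s * bF κ (v s) < q s * cF m l (v s)
    obtain ⟨-, -, -, hus, hvs, hqs, hHs, hFs⟩ := hIoo s hs
    have bu := bF_sq hκ (u s)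
    have bv := bF_sq hκ (v s)
    have cu := cF_sq hκ1 hl hlm hX (Set.Ioo_subset_Icc_self hus)
    have cv := cF_sq hκ1 hl hlm hX (Set.Ioo_subset_Icc_self hvs)
    have lu := x_lt_bF hκ hκ1 hX hus
    have lv := x_lt_bF hκ hκ1 hX hvs
    have lu' := bF_lt_cF hκ hκ1 hl hlm hX hus
    have lv' := bF_lt_cF hκ hκ1 hl hlm hX hvs
    have hus0 := hus.1
    have hvs0 := hvs.1
    have hFs' : m * (q s ^ 3 * (fF κ (u s) + fF κ (v s))) = 9 * η ^ 2 * Rμ := by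
      rw [hFs]; field_simp
    have hGs : q s ^ 3 * (gF κ m l (u s) + gF κ m l (v s)) = 9 * Rμ := by
      have : m / η ^ 2 * (9 * η ^ 2 * Rμ / m) = 9 * Rμ := by field_simp
      unfold hF at hHs
      linear_combination (m / η ^ 2) * hFs - q s ^ 3 * hHs + this
    unfold fF at hFs'
    unfold gF at hGs
    refine ⟨⟨?_, ?_, ?_, ?_, ?_⟩, ?_, ?_, ?_, ?_, ?_, ?_⟩
    · linear_combination q s ^ 2 * (cu - m * bu - u s ^ 2 * hlm)
    · linear_combination q s ^ 2 * (cv - m * bv - v s ^ 2 * hlm)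
    · linear_combination q s ^ 2 * (R * (cu - cv) + m * (bu - bv) + (u s ^ 2 - v s ^ 2) * hκR)
    · linear_combination hFs'
    · linear_combination hGs
    · exact neg_lt_neg (mul_lt_mul_of_pos_left lu' hqs)
    · exact neg_lt_neg (mul_lt_mul_of_pos_left lu hqs)
    · exact neg_lt_zero.2 (by positivity)
    · positivity
    · exact mul_lt_mul_of_pos_left lv hqs
    · exact mul_lt_mul_of_pos_left lv' hqs
  · intro k
    fin_cases k
    · change q a * cF m l (v a) = - -(q b * cF m l (u b))
      rw [hs2, hs3]; ring
    · change q a * bF κ (v a) = - -(q b * bF κ (u b))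
      rw [hs2, hs3]; ring
    · change q a * v a = - -(q b * u b)
      rw [hs2, hs3]; ring
    · change -(q a * u a) = -(q b * v b)
      rw [hs1, hs3]
    · change -(q a * bF κ (u a)) = -(q b * bF κ (v b))
      rw [hs1, hs3]
    · change -(q a * cF m l (u a)) = -(q b * cF m l (v b))
      rw [hs1, hs3]
end

section
/- (Proposition 3.4(i), non-symmetric profile with connected supports) Let R, Rμ, η be positive reals with Rμ > R + 1, and let (β₁, α, β, γ) be a solution of system (S2) with β₁ < 0 ≤ α < β < γ. Define F, G : ℝ → ℝ by: η²F(x) := (β₁² − x²)/(6(1+R)) for β₁ ≤ x ≤ α, η²F(x) := (Rμ−R)(β² − x²)/(6Rμ) for α ≤ x ≤ β, and F(x) := 0 for x ≤ β₁ and x ≥ β; G(x) := (1+R−Rμ)(α² − x²)/(6Rμ) for α ≤ x ≤ β, G(x) := (γ² − x²)/(6Rμ) for β ≤ x ≤ γ, and G(x) := 0 for x ≤ α and x ≥ γ. Then (F, G) is a steady profile for (R, Rμ, η) which is not even: indeed G(β₁) = 0 < G(−β₁). -/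
open MeasureTheory

/-- A pair `(F, G)` of continuous, nonnegative, integrable functions of unit mass is a
steady profile for the parameters `(R, Rμ, η)` if the function
`x ↦ η²(1+R)F(x) + R G(x) + x²/6` is constant on every connected component of
`{x | F x > 0}` and `x ↦ η² Rμ F(x) + Rμ G(x) + x²/6` is constant on every connected
component of `{x | G x > 0}`. -/
def IsSteadyProfile (R Rμ η : ℝ) (F G : ℝ → ℝ) : Prop :=
  Continuous F ∧ Continuous G ∧
  (∀ x, 0 ≤ F x) ∧ (∀ x, 0 ≤ G x) ∧
  Integrable F ∧ Integrable G ∧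
  (∫ x, F x) = 1 ∧ (∫ x, G x) = 1 ∧
  (∀ x, 0 < F x → ∀ y ∈ connectedComponentIn {z : ℝ | 0 < F z} x,
      η ^ 2 * (1 + R) * F y + R * G y + y ^ 2 / 6
        = η ^ 2 * (1 + R) * F x + R * G x + x ^ 2 / 6) ∧
  (∀ x, 0 < G x → ∀ y ∈ connectedComponentIn {z : ℝ | 0 < G z} x,
      η ^ 2 * Rμ * F y + Rμ * G y + y ^ 2 / 6
        = η ^ 2 * Rμ * F x + Rμ * G x + x ^ 2 / 6)

/-- System (S2) of algebraic equations determining the non-symmetric self-similar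
profiles with connected supports. -/
def SystemS2 (R Rμ η β₁ α β γ : ℝ) : Prop :=
  Rμ * β₁ ^ 3 - (1 + R) * (Rμ - R) * β ^ 3 + R * (Rμ - R - 1) * α ^ 3
    = -(9 * η ^ 2 * Rμ * (1 + R)) ∧
  γ ^ 3 - (Rμ - R) * β ^ 3 + (Rμ - R - 1) * α ^ 3 = 9 * Rμ ∧
  γ ^ 2 - (Rμ - R) * β ^ 2 + (Rμ - R - 1) * α ^ 2 = 0 ∧
  Rμ * β₁ ^ 2 - (1 + R) * (Rμ - R) * β ^ 2 + R * (Rμ - R - 1) * α ^ 2 = 0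

theorem aux_piece (f : ℝ → ℝ) (a b c A₁ B₁ A₂ B₂ : ℝ) (hab : a < b) (hbc : b < c)
    (hf : ∀ x, f x = if x < a then 0 else if x ≤ b then A₁ + B₁ * x ^ 2
      else if x ≤ c then A₂ + B₂ * x ^ 2 else 0)
    (ha : A₁ + B₁ * a ^ 2 = 0) (hb : A₁ + B₁ * b ^ 2 = A₂ + B₂ * b ^ 2)
    (hc : A₂ + B₂ * c ^ 2 = 0) :
    Continuous f ∧ Integrable f ∧
    (∫ x, f x) = A₁ * (b - a) + B₁ * (b ^ 3 - a ^ 3) / 3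
      + (A₂ * (c - b) + B₂ * (c ^ 3 - b ^ 3) / 3) := by
  have hcont : Continuous f := by
    have h : f = fun x => if x ≤ a then 0 else if x ≤ b then A₁ + B₁ * x ^ 2
        else if x ≤ c then A₂ + B₂ * x ^ 2 else 0 := by
      funext x
      rw [hf]
      rcases lt_trichotomy x a with h | h | h
      · simp [h, h.le]
      · subst h; simp [hab.le, ha]
      · simp [h.not_gt, h.not_ge]
    rw [h]
    refine Continuous.if_le continuous_const ?_ continuous_id continuous_const ?_
    · refine Continuous.if_le (by fun_prop) ?_ continuous_id continuous_const ?_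
      · refine Continuous.if_le (by fun_prop) (by fun_prop) continuous_id continuous_const ?_
        rintro x rfl; exact hc
      · rintro x rfl
        rw [if_pos hbc.le]; exact hb
    · rintro x rfl
      rw [if_pos hab.le]; exact ha.symm
  have h0 : ∀ x, x ≤ a ∨ c < x → f x = 0 := by
    intro x hx
    rw [hf]
    rcases hx with h | h
    · rcases h.lt_or_eq with h | h
      · simp [h]
      · subst h; simp [hab.le, ha]
    · rw [if_neg (by linarith), if_neg (by linarith), if_neg (by linarith)]
  have hsupp : Function.support f ⊆ Set.Ioc a c := by
    intro x hx
    by_contra hn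
    apply hx
    apply h0
    by_contra! h
    exact hn ⟨h.1, h.2⟩
  have hcs : HasCompactSupport f :=
    HasCompactSupport.of_support_subset_isCompact (isCompact_Icc (a := a) (b := c))
      (hsupp.trans Set.Ioc_subset_Icc_self)
  refine ⟨hcont, hcont.integrable_of_hasCompactSupport hcs, ?_⟩
  rw [← intervalIntegral.integral_eq_integral_of_support_subset hsupp,
    ← intervalIntegral.integral_add_adjacent_intervals (hcont.intervalIntegrable a b)
      (hcont.intervalIntegrable b c)]
  have e1 : ∫ x in a..b, f x = ∫ x in a..b, (A₁ + B₁ * x ^ 2) := by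
    apply intervalIntegral.integral_congr
    intro x hx
    rw [Set.uIcc_of_le hab.le] at hx
    show f x = _
    rw [hf, if_neg (not_lt.2 hx.1), if_pos hx.2]
  have e2 : ∫ x in b..c, f x = ∫ x in b..c, (A₂ + B₂ * x ^ 2) := by
    apply intervalIntegral.integral_congr
    intro x hx
    rw [Set.uIcc_of_le hbc.le] at hx
    show f x = _
    rw [hf, if_neg (by linarith [hx.1])]
    rcases hx.1.eq_or_lt with h | h
    · subst h; rw [if_pos le_rfl]; exact hb
    · rw [if_neg (by linarith), if_pos hx.2]
  have key : ∀ A B u v : ℝ, ∫ x in u..v, (A + B * x ^ 2)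
      = A * (v - u) + B * (v ^ 3 - u ^ 3) / 3 := by
    intro A B u v
    rw [intervalIntegral.integral_add (by simp)
      ((by fun_prop : Continuous fun x : ℝ => B * x ^ 2).intervalIntegrable _ _),
      intervalIntegral.integral_const_mul, integral_pow]
    simp
    ring
  rw [e1, e2, key, key]

set_option maxHeartbeats 2000000

/-- Proposition 3.4(i): a solution of system (S2) with `β₁ < 0 ≤ α < β < γ` yields a
non-symmetric steady profile with connected supports; non-symmetry is witnessed by
`G(β₁) = 0 < G(−β₁)`. -/
theorem nonsymmetric_steadyProfile_connected (R Rμ η : ℝ)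
    (hR : 0 < R) (hRμ : 0 < Rμ) (hη : 0 < η) (hgt : R + 1 < Rμ)
    (β₁ α β γ : ℝ) (hβ₁ : β₁ < 0) (hα : 0 ≤ α) (hαβ : α < β) (hβγ : β < γ)
    (hsol : SystemS2 R Rμ η β₁ α β γ)
    (F G : ℝ → ℝ)
    (hF : ∀ x, F x =
      if x < β₁ then 0
      else if x ≤ α then (β₁ ^ 2 - x ^ 2) / (6 * (1 + R)) / η ^ 2
      else if x ≤ β then (Rμ - R) * (β ^ 2 - x ^ 2) / (6 * Rμ) / η ^ 2
      else 0)
    (hG : ∀ x, G x =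
      if x < α then 0
      else if x ≤ β then (1 + R - Rμ) * (α ^ 2 - x ^ 2) / (6 * Rμ)
      else if x ≤ γ then (γ ^ 2 - x ^ 2) / (6 * Rμ)
      else 0) :
    IsSteadyProfile R Rμ η F G ∧ G β₁ = 0 ∧ 0 < G (-β₁) := by
  obtain ⟨s1, s2, s3, s4⟩ := hsol
  have hR1 : 0 < 1 + R := by linarith
  have hd : 0 < β ^ 2 - α ^ 2 := by nlinarith
  have hc0 : 0 < Rμ - R - 1 := by linarith
  have hβp : 0 < β := by linarith
  have hb1 : β < -β₁ := by
    have h : Rμ * β ^ 2 < Rμ * β₁ ^ 2 := by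
      have := mul_pos (mul_pos hR hc0) hd
      nlinarith
    have h' := lt_of_mul_lt_mul_left h hRμ.le
    nlinarith
  have hb2 : -β₁ < γ := by
    have h : Rμ * β₁ ^ 2 < Rμ * γ ^ 2 := by
      have := mul_pos (mul_pos (show 0 < Rμ - R by linarith) hc0) hd
      have e : Rμ * γ ^ 2 = Rμ * ((Rμ - R) * β ^ 2 - (Rμ - R - 1) * α ^ 2) := by
        congr 1; linarith
      nlinarith
    have h' := lt_of_mul_lt_mul_left h hRμ.le
    nlinarith
  have hη' := hη.ne'
  have hRμ' := hRμ.ne'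
  have hR1' := hR1.ne'
  have c4 : β₁ ^ 2 = ((1 + R) * (Rμ - R) * β ^ 2 - R * (Rμ - R - 1) * α ^ 2) / Rμ := by
    field_simp; linarith
  have c3 : γ ^ 2 = (Rμ - R) * β ^ 2 - (Rμ - R - 1) * α ^ 2 := by linarith
  have c1 : β₁ ^ 3 = ((1 + R) * (Rμ - R) * β ^ 3 - R * (Rμ - R - 1) * α ^ 3
      - 9 * η ^ 2 * Rμ * (1 + R)) / Rμ := by
    field_simp; linarith
  have c2 : γ ^ 3 = (Rμ - R) * β ^ 3 - (Rμ - R - 1) * α ^ 3 + 9 * Rμ := by linarith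
  obtain ⟨Fc, Fi, Fm⟩ := aux_piece F β₁ α β (β₁ ^ 2 / (6 * (1 + R)) / η ^ 2)
    (-1 / (6 * (1 + R)) / η ^ 2) ((Rμ - R) * β ^ 2 / (6 * Rμ) / η ^ 2)
    (-(Rμ - R) / (6 * Rμ) / η ^ 2) (by linarith) hαβ
    (by
      intro x
      rw [hF]
      congr 1
      congr 1
      · ring
      · congr 1
        ring)
    (by ring) (by rw [c4]; field_simp; ring) (by ring)
  obtain ⟨Gc, Gi, Gm⟩ := aux_piece G α β γ ((1 + R - Rμ) * α ^ 2 / (6 * Rμ))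
    (-(1 + R - Rμ) / (6 * Rμ)) (γ ^ 2 / (6 * Rμ))
    (-1 / (6 * Rμ)) hαβ hβγ
    (by
      intro x
      rw [hG]
      congr 1
      congr 1
      · ring
      · congr 1
        ring)
    (by ring) (by rw [c3]; field_simp; ring) (by ring)
  have hFpos : ∀ x, 0 < F x → β₁ < x ∧ x < β := by
    intro x hx
    rw [hF] at hx
    constructor
    · by_contra! h
      rcases h.lt_or_eq with h | h
      · simp [h] at hx
      · subst h
        rw [if_neg (lt_irrefl _), if_pos (by linarith)] at hx
        simp at hx
    · by_contra! h
      rw [if_neg (by linarith), if_neg (by linarith)] at hx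
      rcases h.lt_or_eq with h | h
      · rw [if_neg (by linarith)] at hx; simp at hx
      · subst h; simp at hx
  have hGpos : ∀ x, 0 < G x → α < x ∧ x < γ := by
    intro x hx
    rw [hG] at hx
    constructor
    · by_contra! h
      rcases h.lt_or_eq with h | h
      · simp [h] at hx
      · subst h
        rw [if_neg (lt_irrefl _), if_pos (by linarith)] at hx
        simp at hx
    · by_contra! h
      rw [if_neg (by linarith), if_neg (by linarith)] at hx
      rcases h.lt_or_eq with h | h
      · rw [if_neg (by linarith)] at hx; simp at hx
      · subst h; simp at hx
  have hFconst : ∀ x, 0 < F x →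
      η ^ 2 * (1 + R) * F x + R * G x + x ^ 2 / 6 = β₁ ^ 2 / 6 := by
    intro x hx
    obtain ⟨h1, h2⟩ := hFpos x hx
    rw [hF, hG, if_neg (by linarith)]
    rcases lt_trichotomy x α with h | h | h
    · rw [if_pos h.le, if_pos h]; field_simp; ring
    · subst h
      rw [if_pos le_rfl, if_neg (lt_irrefl _), if_pos h2.le]; field_simp; ring
    · rw [if_neg (by linarith), if_pos h2.le, if_neg (by linarith), if_pos h2.le, c4]
      field_simp; ring
  have hGconst : ∀ x, 0 < G x →
      η ^ 2 * Rμ * F x + Rμ * G x + x ^ 2 / 6 = γ ^ 2 / 6 := by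
    intro x hx
    obtain ⟨h1, h2⟩ := hGpos x hx
    have n1 : ¬ x < β₁ := by linarith
    have n2 : ¬ x ≤ α := by linarith
    have n3 : ¬ x < α := by linarith
    rw [hF, hG, if_neg n1, if_neg n2, if_neg n3]
    rcases le_or_gt x β with h | h
    · rw [if_pos h, if_pos h, c3]; field_simp; ring
    · rw [if_neg h.not_ge, if_neg h.not_ge, if_pos h2.le]; field_simp; ring
  refine ⟨⟨Fc, Gc, ?_, ?_, Fi, Gi, ?_, ?_, ?_, ?_⟩, ?_, ?_⟩
  · intro x
    rw [hF]
    split_ifs with h1 h2 h3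
    · exact le_rfl
    · have : 0 ≤ β₁ ^ 2 - x ^ 2 := by
        have := sq_le_sq' (a := x) (b := -β₁) (by linarith) (by linarith)
        rw [neg_sq] at this; linarith
      positivity
    · have : 0 ≤ β ^ 2 - x ^ 2 := by
        have := sq_le_sq' (a := x) (b := β) (by linarith) (by linarith)
        linarith
      have : 0 ≤ Rμ - R := by linarith
      positivity
    · exact le_rfl
  · intro x
    rw [hG]
    split_ifs with h1 h2 h3
    · exact le_rfl
    · have : α ^ 2 ≤ x ^ 2 := pow_le_pow_left₀ hα (by linarith) 2
      have : 0 ≤ (1 + R - Rμ) * (α ^ 2 - x ^ 2) :=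
        mul_nonneg_of_nonpos_of_nonpos (by linarith) (by linarith)
      positivity
    · have : 0 ≤ γ ^ 2 - x ^ 2 := by
        have := sq_le_sq' (a := x) (b := γ) (by linarith) (by linarith)
        linarith
      positivity
    · exact le_rfl
  · rw [Fm]
    have e : β₁ ^ 2 / (6 * (1 + R)) / η ^ 2 * (α - β₁)
        = (β₁ ^ 2 * α - β₁ ^ 3) / (6 * (1 + R)) / η ^ 2 := by ring
    rw [e, c1, c4]; field_simp; ring
  · rw [Gm]
    have e : γ ^ 2 / (6 * Rμ) * (γ - β)
        = (γ ^ 3 - γ ^ 2 * β) / (6 * Rμ) := by ring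
    rw [e, c2, c3]; field_simp; ring
  · intro x hx y hy
    have hy' : 0 < F y := connectedComponentIn_subset {z : ℝ | 0 < F z} x hy
    rw [hFconst x hx, hFconst y hy']
  · intro x hx y hy
    have hy' : 0 < G y := connectedComponentIn_subset {z : ℝ | 0 < G z} x hy
    rw [hGconst x hx, hGconst y hy']
  · rw [hG, if_pos (by linarith)]
  · rw [hG, if_neg (by linarith), if_neg (by linarith), if_pos hb2.le]
    have : 0 < γ ^ 2 - (-β₁) ^ 2 := by
      have := pow_lt_pow_left₀ hb2 (by linarith) two_ne_zero
      linarith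
    positivity
end
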